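/- arXiv:math/0206187 — 6 statements merged into one kernel-verified Lean document; each statement's English description precedes it below -/
import Mathlib

section
/- In the invariant exterior algebra of the 4D bicovariant calculus on C_q[SL_2], the element e_z = q^{-2} e_a - e_d satisfies the relations e_z e_c + q^2 e_c e_z = 0, e_b e_z + q^2 e_z e_b = 0, and e_z e_z = (1 - q^{-4}) e_c e_b. -/
/-- In the invariant exterior algebra of the 4D bicovariant calculus on
`ℂ_q[SL₂]`, the element `e_z = q⁻² e_a − e_d` satisfies
`e_z e_c + q² e_c e_z = 0`, `e_b e_z + q² e_z e_b = 0`, and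
`e_z e_z = (1 − q⁻⁴) e_c e_b`. -/
theorem ez_relations (q : ℂ) (hq : q ≠ 0) (hq2 : q ^ 2 ≠ 1)
    (μ : ℂ) (hμ : μ = 1 - q⁻¹ ^ 2)
    (Λ : Type*) [Ring Λ] [Algebra ℂ Λ]
    (ea eb ec ed ez θ : Λ)
    (hez : ez = q⁻¹ ^ 2 • ea - ed) (hθ : θ = ea + ed)
    (raa : ea * ea = 0) (rbb : eb * eb = 0) (rcc : ec * ec = 0)
    (rab : ea * eb + eb * ea = 0) (rac : ea * ec + ec * ea = 0)
    (rbc : eb * ec + ec * eb = 0)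
    (rad : ea * ed + ed * ea + μ • (ec * eb) = 0)
    (rdc : ed * ec + q ^ 2 • (ec * ed) + μ • (ea * ec) = 0)
    (rbd : eb * ed + q ^ 2 • (ed * eb) + μ • (eb * ea) = 0)
    (rdd : ed * ed = μ • (ec * eb)) :
    ez * ec + q ^ 2 • (ec * ez) = 0 ∧
    eb * ez + q ^ 2 • (ez * eb) = 0 ∧
    ez * ez = (1 - q⁻¹ ^ 4) • (ec * eb) := by
  subst hez hμ
  have hac : ea * ec = -(ec * ea) := eq_neg_of_add_eq_zero_left rac
  have hab : ea * eb = -(eb * ea) := eq_neg_of_add_eq_zero_left rab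
  simp only [sub_mul, mul_sub, smul_mul_assoc, mul_smul_comm, smul_sub, raa, rdd]
  refine ⟨?_, ?_, ?_⟩
  · rw [hac] at rdc ⊢
    linear_combination (norm := skip) (-1 : ℂ) • rdc
    match_scalars <;> field_simp <;> ring
  · rw [hab]
    linear_combination (norm := skip) (-1 : ℂ) • rbd
    match_scalars <;> field_simp <;> ring
  · linear_combination (norm := skip) (-q⁻¹ ^ 2) • rad
    match_scalars <;> field_simp <;> ring
end

section
/- (Lemma 2.1, e_c part.) For all natural numbers k, n, m one has e_c · c^k b^n d^m = c^k b^n d^m · e_c + q^{k−m} μ [k] c^{k−1} b^n d^{m+1} e_a, with the convention that a summand whose coefficient is [0] (i.e. which would involve a negative power of c) is zero. -/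
/-- If `x` and `y` `s`-commute, then `x` and `y ^ n` commute up to `s ^ n`. -/
theorem mul_pow_eq_smul_of_mul_eq_smul {R A : Type*} [CommSemiring R] [Semiring A] [Algebra R A]
    {x y : A} {s : R} (h : x * y = s • (y * x)) (n : ℕ) :
    x * y ^ n = s ^ n • (y ^ n * x) := by
  induction n with
  | zero => simp
  | succ n ih =>
    rw [pow_succ, ← mul_assoc, ih, smul_mul_assoc, mul_assoc, h, mul_smul_comm, smul_smul,
      ← mul_assoc, ← pow_succ]

/-- Moving `x` past a power of `y`, when the commutator of `x` and `y` is a multiple of `d * e` and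
`d`, `e` both `q`-commute with `y`. -/
theorem mul_pow_succ_eq_add_smul {R A : Type*} [CommRing R] [Ring A] [Algebra R A]
    {x y d e : A} {q s : R} (hx : x * y - y * x = s • (d * e))
    (hd : d * y = q • (y * d)) (he : e * y = q • (y * e)) (k : ℕ) :
    x * y ^ (k + 1) = y ^ (k + 1) * x +
      (s * ∑ i ∈ Finset.range (k + 1), (q ^ 2) ^ i) • (y ^ k * d * e) := by
  have hx' : x * y = y * x + s • (d * e) := by rw [← hx]; abel
  induction k with
  | zero => simp [hx']
  | succ k ih =>
    have hde : y ^ k * d * e * y = q ^ 2 • (y ^ (k + 1) * d * e) := by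
      rw [mul_assoc, he, mul_smul_comm, mul_assoc, ← mul_assoc d, hd, smul_mul_assoc,
        mul_smul_comm, smul_smul, pow_two, pow_succ]
      simp only [mul_assoc]
    rw [pow_succ y (k + 1), ← mul_assoc, ih, add_mul, smul_mul_assoc, hde, smul_smul, mul_assoc,
      hx', mul_add, mul_smul_comm, ← mul_assoc, ← mul_assoc, add_assoc, ← add_smul,
      Finset.sum_range_succ' _ (k + 1)]
    congr 2
    simp only [pow_succ (q ^ 2), ← Finset.sum_mul]
    ring

/-- Lemma 2.1, `e_c` part: for all natural `k n m`,
`e_c · cᵏ bⁿ dᵐ = cᵏ bⁿ dᵐ · e_c + q^{k−m} μ [k] c^{k−1} bⁿ d^{m+1} e_a`,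
with the convention that a summand whose coefficient is `[0]` is zero
(here `[0] = br 0 = 0`, so the natural-subtraction power `c ^ (k-1)` is harmless). -/
theorem lemma21_ec_part
    (q : ℂ) (hq : q ≠ 0) (hq2 : q ^ 2 ≠ 1)
    (μ : ℂ) (hμ : μ = 1 - q⁻¹ ^ 2)
    (br : ℕ → ℂ) (hbr : ∀ n : ℕ, br n = (q ^ n - q⁻¹ ^ n) / (q - q⁻¹))
    (P : Type*) [Ring P] [Algebra ℂ P]
    (a b c d : P) (D : Pˣ) (hD : (D : P) = d)
    (dz : ℤ → P) (hdz : ∀ t : ℤ, dz t = ((D ^ t : Pˣ) : P))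
    (hba : b * a = q • (a * b)) (hca : c * a = q • (a * c))
    (hdb : d * b = q • (b * d)) (hdc : d * c = q • (c * d))
    (hcb : c * b = b * c)
    (hda : d * a - a * d = (q * μ) • (b * c))
    (had : a * d - q⁻¹ • (b * c) = 1)
    (ea eb ec ed : P)
    (r1 : ea * a = q • (a * ea)) (r2 : ea * b = q⁻¹ • (b * ea))
    (r3 : ea * c = q • (c * ea)) (r4 : ea * d = q⁻¹ • (d * ea))
    (r5 : ec * b = b * ec) (r6 : ec * d = d * ec)
    (r7 : eb * a = a * eb) (r8 : eb * c = c * eb)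
    (r9 : ec * a - a * ec = (q * μ) • (b * ea))
    (r10 : ec * c - c * ec = (q * μ) • (d * ea))
    (r11 : eb * b - b * eb = (q * μ) • (a * ea))
    (r12 : eb * d - d * eb = (q * μ) • (c * ea))
    (r13 : ed * a - q⁻¹ • (a * ed) = μ • (b * eb))
    (r14 : ed * b - q • (b * ed) = μ • (a * ec) + (q * μ ^ 2) • (b * ea))
    (r15 : ed * c - q⁻¹ • (c * ed) = μ • (d * eb))
    (r16 : ed * d - q • (d * ed) = μ • (c * ec) + (q * μ ^ 2) • (d * ea))
    (k n m : ℕ) :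
    ec * (c ^ k * b ^ n * dz m) =
      c ^ k * b ^ n * dz m * ec +
      (q ^ ((k : ℤ) - m) * μ * br k) • (c ^ (k - 1) * b ^ n * dz (m + 1) * ea) := by
  have hz (j : ℕ) : dz j = d ^ j := by rw [hdz, zpow_natCast, Units.val_pow_eq_pow_val, hD]
  have hz1 : dz (m + 1) = d ^ (m + 1) := by exact_mod_cast hz (m + 1)
  rw [hz, hz1]
  have hec : b ^ n * d ^ m * ec = ec * (b ^ n * d ^ m) :=
    ((Commute.pow_right r5 n).mul_right (Commute.pow_right r6 m)).symm
  cases k with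
  | zero => simp [hbr, hec]
  | succ k =>
    have hmove : d * ea * (b ^ n * d ^ m) = q⁻¹ ^ m • (b ^ n * d ^ (m + 1) * ea) := by
      have h1 := mul_pow_eq_smul_of_mul_eq_smul r2 n
      have h2 := mul_pow_eq_smul_of_mul_eq_smul r4 m
      have h3 := mul_pow_eq_smul_of_mul_eq_smul hdb n
      calc d * ea * (b ^ n * d ^ m) = d * (ea * b ^ n) * d ^ m := by simp only [mul_assoc]
        _ = q⁻¹ ^ n • (d * b ^ n * (ea * d ^ m)) := by
          rw [h1]; simp only [mul_smul_comm, smul_mul_assoc, mul_assoc]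
        _ = (q⁻¹ ^ n * (q ^ n * q⁻¹ ^ m)) • (b ^ n * d ^ (m + 1) * ea) := by
          rw [h2, h3, pow_succ' d]
          simp only [mul_smul_comm, smul_mul_assoc, mul_assoc, smul_smul]
          congr 1
          ring
        _ = _ := by rw [← mul_assoc, ← mul_pow, inv_mul_cancel₀ hq, one_pow, one_mul]
    have hcoef : q * μ * (∑ i ∈ Finset.range (k + 1), (q ^ 2) ^ i) * q⁻¹ ^ m =
        q ^ (((k + 1 : ℕ) : ℤ) - m) * μ * br (k + 1) := by
      have h1 : q ^ 2 - 1 ≠ 0 := sub_ne_zero.mpr hq2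
      have h2 : q - q⁻¹ = (q ^ 2 - 1) / q := by field_simp
      rw [geom_sum_eq hq2, hbr, h2, zpow_sub₀ hq, zpow_natCast, zpow_natCast]
      simp only [inv_pow]
      field_simp
      ring
    have hc := mul_pow_succ_eq_add_smul r10 hdc r3 k
    rw [mul_assoc (c ^ (k + 1)), ← mul_assoc ec, hc, add_mul, mul_assoc (c ^ (k + 1)) ec, ← hec,
      smul_mul_assoc, mul_assoc (c ^ k), mul_assoc (c ^ k), hmove, mul_smul_comm, smul_smul, hcoef,
      Nat.add_sub_cancel]
    simp only [mul_assoc]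
end

section
/- (Lemma 2.1, e_b part.) For all natural numbers k, n, m one has e_b · c^k b^n d^m = c^k b^n d^m · e_b + q² μ [n] q^{−m−n} c^k b^{n−1} d^{m−1} e_a + q^{1−n} μ [m+n] c^{k+1} b^n d^{m−1} e_a, with the convention that a summand whose coefficient is [0] (i.e. which would involve a negative power of b) is zero; powers d^{m−1} with m = 0 are interpreted using the inverse of d. -/
/-- A `q`-commuting generator satisfies `xⁿ u = qⁿ u xⁿ`. -/
theorem pow_mul_of_smul_comm {P : Type*} [Ring P] [Algebra ℂ P] {r : ℂ} {x u : P}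
    (h : x * u = r • (u * x)) (n : ℕ) : x ^ n * u = r ^ n • (u * x ^ n) := by
  induction n with
  | zero => simp
  | succ n ih =>
    rw [pow_succ, mul_assoc, h, mul_smul_comm, ← mul_assoc, ih, smul_mul_assoc, smul_smul,
      mul_assoc, pow_succ' r]

/-- A `q`-commuting generator satisfies `u xⁿ = qⁿ xⁿ u`. -/
theorem mul_pow_of_smul_comm {P : Type*} [Ring P] [Algebra ℂ P] {r : ℂ} {x u : P}
    (h : u * x = r • (x * u)) (n : ℕ) : u * x ^ n = r ^ n • (x ^ n * u) := by
  induction n with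
  | zero => simp
  | succ n ih =>
    rw [pow_succ, ← mul_assoc, ih, smul_mul_assoc, mul_assoc, h, mul_smul_comm, smul_smul,
      mul_assoc, pow_succ r]

/-- Commutation past a power, for a `q`-derivation-like commutator. -/
theorem mul_pow_of_commutator {P : Type*} [Ring P] [Algebra ℂ P] {q s : ℂ} {br : ℕ → ℂ}
    (br_zero : br 0 = 0) (br_succ : ∀ n, br (n + 1) = q ^ n + q⁻¹ * br n) {E A x u : P}
    (hE : E * x - x * E = s • (u * A)) (hA : A * x = q⁻¹ • (x * A))
    (hx : x * u = q • (u * x)) (n : ℕ) :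
    E * x ^ n = x ^ n * E + (s * br n) • (u * x ^ (n - 1) * A) := by
  induction n with
  | zero => simp [br_zero]
  | succ n ih =>
    have h : br n • (u * x ^ (n - 1) * x) = br n • (u * x ^ n) := by
      rcases n with _ | n
      · simp [br_zero]
      · simp [pow_succ, mul_assoc]
    calc E * x ^ (n + 1) = E * x ^ n * x := by rw [pow_succ, mul_assoc]
      _ = x ^ n * (E * x) + (s * br n) • (u * x ^ (n - 1) * (A * x)) := by
        rw [ih, add_mul, smul_mul_assoc, mul_assoc, mul_assoc _ A]
      _ = x ^ n * x * E + s • (x ^ n * u * A)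
          + (s * q⁻¹) • (br n • (u * x ^ (n - 1) * x) * A) := by
        rw [sub_eq_iff_eq_add'.mp hE, hA]
        simp only [mul_add, mul_smul_comm, smul_mul_assoc, smul_smul, mul_assoc]
        congr 2
        ring
      _ = _ := by
        rw [h, pow_mul_of_smul_comm hx, br_succ, add_tsub_cancel_right, pow_succ]
        simp only [smul_mul_assoc, smul_smul]
        module


/-- Lemma 2.1, `e_b` part: for all natural `k n m`,
`e_b · cᵏ bⁿ dᵐ = cᵏ bⁿ dᵐ · e_b + q² μ [n] q^{−m−n} cᵏ b^{n−1} d^{m−1} e_a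
 + q^{1−n} μ [m+n] c^{k+1} bⁿ d^{m−1} e_a`,
with the convention that a summand whose coefficient is `[0]` is zero;
the powers `d^{m−1}` (possibly negative) are taken via the unit `D`. -/
theorem lemma21_eb_part
    (q : ℂ) (hq : q ≠ 0) (hq2 : q ^ 2 ≠ 1)
    (μ : ℂ) (hμ : μ = 1 - q⁻¹ ^ 2)
    (br : ℕ → ℂ) (hbr : ∀ n : ℕ, br n = (q ^ n - q⁻¹ ^ n) / (q - q⁻¹))
    (P : Type*) [Ring P] [Algebra ℂ P]
    (a b c d : P) (D : Pˣ) (hD : (D : P) = d)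
    (dz : ℤ → P) (hdz : ∀ t : ℤ, dz t = ((D ^ t : Pˣ) : P))
    (hba : b * a = q • (a * b)) (hca : c * a = q • (a * c))
    (hdb : d * b = q • (b * d)) (hdc : d * c = q • (c * d))
    (hcb : c * b = b * c)
    (hda : d * a - a * d = (q * μ) • (b * c))
    (had : a * d - q⁻¹ • (b * c) = 1)
    (ea eb ec ed : P)
    (r1 : ea * a = q • (a * ea)) (r2 : ea * b = q⁻¹ • (b * ea))
    (r3 : ea * c = q • (c * ea)) (r4 : ea * d = q⁻¹ • (d * ea))
    (r5 : ec * b = b * ec) (r6 : ec * d = d * ec)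
    (r7 : eb * a = a * eb) (r8 : eb * c = c * eb)
    (r9 : ec * a - a * ec = (q * μ) • (b * ea))
    (r10 : ec * c - c * ec = (q * μ) • (d * ea))
    (r11 : eb * b - b * eb = (q * μ) • (a * ea))
    (r12 : eb * d - d * eb = (q * μ) • (c * ea))
    (r13 : ed * a - q⁻¹ • (a * ed) = μ • (b * eb))
    (r14 : ed * b - q • (b * ed) = μ • (a * ec) + (q * μ ^ 2) • (b * ea))
    (r15 : ed * c - q⁻¹ • (c * ed) = μ • (d * eb))
    (r16 : ed * d - q • (d * ed) = μ • (c * ec) + (q * μ ^ 2) • (d * ea))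
    (k n m : ℕ) :
    eb * (c ^ k * b ^ n * dz m) =
      c ^ k * b ^ n * dz m * eb +
      (q ^ 2 * μ * br n * q ^ (-(m : ℤ) - n)) • (c ^ k * b ^ (n - 1) * dz ((m : ℤ) - 1) * ea) +
      (q ^ (1 - (n : ℤ)) * μ * br (m + n)) • (c ^ (k + 1) * b ^ n * dz ((m : ℤ) - 1) * ea) := by
  have hq' : q - q⁻¹ ≠ 0 := by
    intro h
    apply hq2
    field_simp at h
    linear_combination h
  have br_zero : br 0 = 0 := by simp [hbr]
  have br_add (i j : ℕ) : br (i + j) = q ^ j * br i + q⁻¹ ^ i * br j := by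
    simp only [hbr, pow_add]
    field_simp
    ring
  have br_succ (i : ℕ) : br (i + 1) = q ^ i + q⁻¹ * br i := by
    rw [add_comm i, br_add, hbr 1]
    simp [div_self hq']
  have dz_nat : dz m = d ^ m := by simp [hdz, hD]
  have dz_pred : dz ((m : ℤ) - 1) = (↑D⁻¹ : P) * d ^ m := by
    rw [hdz, sub_eq_neg_add, zpow_add, zpow_neg_one, zpow_natCast,
      Units.val_mul, Units.val_pow_eq_pow_val, hD]
  have pow_pred : br m • d ^ (m - 1) = br m • dz ((m : ℤ) - 1) := by
    rcases m with _ | m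
    · simp [br_zero]
    · rw [dz_pred, pow_succ', ← mul_assoc, ← hD]
      simp
  have ha : a = (↑D⁻¹ : P) + q⁻¹ • (b * c * (↑D⁻¹ : P)) := by
    have h := congrArg (· * (↑D⁻¹ : P)) (sub_eq_iff_eq_add.mp had)
    simpa [← hD, mul_assoc, add_mul] using h
  have hb := mul_pow_of_commutator br_zero br_succ r11 r2 hba n
  have hd := mul_pow_of_commutator br_zero br_succ r12 r4 hdc m
  have hbc : b ^ n * c = c * b ^ n := ((show Commute c b from hcb).pow_right n).eq.symm
  have hab : br n • (a * b ^ (n - 1)) = br n • (q ^ (1 - (n : ℤ)) •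
      (b ^ (n - 1) * (↑D⁻¹ : P) + q⁻¹ • (c * b ^ n * (↑D⁻¹ : P)))) := by
    rcases n with _ | n
    · simp [br_zero]
    · have h := pow_mul_of_smul_comm hba n
      rw [← inv_smul_eq_iff₀ (pow_ne_zero n hq)] at h
      rw [add_tsub_cancel_right, ← h, ← hbc]
      nth_rw 1 [ha]
      congr 2
      · simp [← zpow_natCast, ← zpow_neg]
      · simp only [mul_add, mul_smul_comm, pow_succ, mul_assoc]
  have hec : c ^ k * eb = eb * c ^ k := ((show Commute eb c from r8).pow_right k).eq.symm
  calc eb * (c ^ k * b ^ n * dz m) = c ^ k * (eb * b ^ n) * d ^ m := by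
        rw [dz_nat, ← mul_assoc, ← mul_assoc, ← mul_assoc, hec]
    _ = c ^ k * b ^ n * (eb * d ^ m)
        + (q * μ) • (c ^ k * (br n • (a * b ^ (n - 1))) * (ea * d ^ m)) := by
        rw [hb]
        simp only [mul_add, add_mul, mul_smul_comm, smul_mul_assoc, smul_smul, mul_assoc]
    _ = c ^ k * b ^ n * d ^ m * eb
        + (q * μ) • (c ^ k * (b ^ n * c) * (br m • d ^ (m - 1)) * ea)
        + (q * μ) • (c ^ k * (br n • (a * b ^ (n - 1))) * (ea * d ^ m)) := by
        rw [hd]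
        simp only [mul_add, mul_smul_comm, smul_mul_assoc, smul_smul, mul_assoc]
    _ = _ := by
        have h₁ : q ^ (-(m : ℤ) - n) = q⁻¹ ^ m * q⁻¹ ^ n := by
          rw [zpow_sub₀ hq, zpow_neg, zpow_natCast, zpow_natCast, inv_pow, inv_pow, div_eq_mul_inv]
        have h₂ : q ^ (1 - (n : ℤ)) = q * q⁻¹ ^ n := by
          rw [zpow_sub₀ hq, zpow_one, zpow_natCast, inv_pow, div_eq_mul_inv]
        rw [pow_pred, hab, mul_pow_of_smul_comm r4, hbc, dz_nat, dz_pred, h₁, h₂, br_add,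
          pow_succ c]
        simp only [mul_add, smul_add, mul_smul_comm, smul_mul_assoc, smul_smul, add_mul, mul_assoc]
        match_scalars <;> simp only [inv_pow] <;> field_simp
end

section
/- (Lemma 2.1, e_d part.) For all natural numbers k, n, m one has e_d · c^k b^n d^m = qμ²([k+1][m+n] c^k b^n d^m + q^{−m}[k][n] c^{k−1} b^{n−1} d^m) e_a + μ [k] qⁿ c^{k−1} b^n d^{m+1} e_b + q^{−k} μ ([n] c^k b^{n−1} d^{m−1} + q^{−1}(q^{m+n}[m] + [n]) c^{k+1} b^n d^{m−1}) e_c + q^{−k+n+m} c^k b^n d^m e_d, with the convention that a summand whose coefficient contains [0] (i.e. which would involve a negative power of b or c) is zero; powers d^{m−1} with m = 0 are interpreted using the inverse of d. -/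
section

variable {P : Type*} [Ring P] [Algebra ℂ P] {q Q : ℂ} {br : ℕ → ℂ}

/-- A relation `x y = s y x` iterates to powers of `y`. -/
theorem mul_pow_of_mul_eq_smul {s : ℂ} {x y : P} (h : x * y = s • (y * x)) (n : ℕ) :
    x * y ^ n = s ^ n • (y ^ n * x) := by
  induction n with
  | zero => simp
  | succ n ih =>
    rw [pow_succ y, ← mul_assoc, ih, smul_mul_assoc, mul_assoc, h, mul_smul_comm, smul_smul,
      mul_assoc, pow_succ]

/-- A relation `x y = s y x` iterates to powers of `x`. -/
theorem pow_mul_of_mul_eq_smul {s : ℂ} {x y : P} (h : x * y = s • (y * x)) (n : ℕ) :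
    x ^ n * y = s ^ n • (y * x ^ n) := by
  induction n with
  | zero => simp
  | succ n ih =>
    rw [pow_succ' x, mul_assoc, ih, mul_smul_comm, ← mul_assoc, h, smul_mul_assoc, smul_smul,
      mul_assoc, pow_succ]

/-- Iterating `x y = y x + s u w`, where `w` and `u` both `q`-commute with `y`. -/
theorem mul_pow_of_qDerivation {s : ℂ} {x y u w : P}
    (hrec : ∀ n, br (n + 1) = q ^ n + Q * br n) (h0 : br 0 = 0)
    (hx : x * y = y * x + s • (u * w)) (hw : w * y = Q • (y * w))
    (hu : y * u = q • (u * y)) (n : ℕ) :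
    x * y ^ (n + 1) = y ^ (n + 1) * x + (s * br (n + 1)) • (u * (y ^ n * w)) := by
  induction n with
  | zero => simp [hx, hrec, h0]
  | succ n ih =>
    have e := pow_mul_of_mul_eq_smul hu (n + 1)
    rw [pow_succ y (n + 1), ← mul_assoc, ih, add_mul, mul_assoc, hx, smul_mul_assoc, mul_assoc,
      mul_assoc, hw, mul_add, mul_smul_comm, ← mul_assoc _ u, e, hrec (n + 1)]
    simp only [mul_smul_comm, smul_mul_assoc, mul_assoc, pow_succ]
    module

/-- Powers of `y` move past `x` when `x y = q y x + s u v + t y w`, with `v` commuting and `w`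
`q`-commuting with `y`. -/
theorem mul_pow_of_qDerivation_two {s t : ℂ} {x y u v w : P}
    (hqQ : q * Q = 1) (hrec : ∀ n, br (n + 1) = q ^ n + Q * br n) (h0 : br 0 = 0)
    (hx : x * y = q • (y * x) + (s • (u * v) + t • (y * w))) (hv : v * y = y * v)
    (hw : w * y = Q • (y * w)) (hu : y * u = q • (u * y)) (n : ℕ) :
    x * y ^ (n + 1) = q ^ (n + 1) • (y ^ (n + 1) * x) +
      ((s * q ^ n * br (n + 1)) • (u * (y ^ n * v)) + (t * br (n + 1)) • (y ^ (n + 1) * w)) := by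
  induction n with
  | zero => simp [hx, hrec, h0]
  | succ n ih =>
    have e := pow_mul_of_mul_eq_smul hu (n + 1)
    rw [pow_succ y (n + 1), ← mul_assoc, ih, add_mul, add_mul, smul_mul_assoc, mul_assoc, hx,
      smul_mul_assoc, smul_mul_assoc, mul_assoc u, mul_assoc (y ^ n), hv, mul_assoc _ w, hw,
      mul_add, mul_add, mul_smul_comm, mul_smul_comm, ← mul_assoc _ u, e, hrec (n + 1)]
    simp only [mul_smul_comm, smul_mul_assoc, mul_assoc, pow_succ]
    match_scalars
    · ring
    · linear_combination (-s * q ^ n * br (n + 1)) * hqQ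
    · ring

/-- Powers of `y` move past `x` when `x y = Q y x + s u v`, with `v` commuting with `y`. -/
theorem mul_pow_of_qDerivation_inv {s : ℂ} {x y u v : P}
    (hrec : ∀ n, br (n + 1) = Q ^ n + q * br n) (h0 : br 0 = 0)
    (hx : x * y = Q • (y * x) + s • (u * v)) (hv : v * y = y * v)
    (hu : u * y = q • (y * u)) (n : ℕ) :
    x * y ^ (n + 1) = Q ^ (n + 1) • (y ^ (n + 1) * x) +
      (s * br (n + 1)) • (y ^ n * (u * v)) := by
  induction n with
  | zero => simp [hx, hrec, h0]
  | succ n ih =>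
    rw [pow_succ y (n + 1), ← mul_assoc, ih, add_mul, smul_mul_assoc, mul_assoc, hx,
      smul_mul_assoc, mul_assoc, mul_assoc, hv, ← mul_assoc u, hu, hrec (n + 1)]
    simp only [mul_smul_comm, smul_mul_assoc, mul_assoc, pow_succ, mul_add]
    module

end


/-- Lemma 2.1, `e_d` part: for all natural `k n m`,
`e_d · cᵏ bⁿ dᵐ = qμ²([k+1][m+n] cᵏ bⁿ dᵐ + q^{−m}[k][n] c^{k−1} b^{n−1} dᵐ) e_a
 + μ [k] qⁿ c^{k−1} bⁿ d^{m+1} e_b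
 + q^{−k} μ ([n] cᵏ b^{n−1} d^{m−1} + q^{−1}(q^{m+n}[m] + [n]) c^{k+1} bⁿ d^{m−1}) e_c
 + q^{−k+n+m} cᵏ bⁿ dᵐ e_d`,
with the convention that a summand whose coefficient contains `[0]` is zero;
the powers `d^{m−1}` (possibly negative) are taken via the unit `D`. -/
theorem lemma21_ed_part
    (q : ℂ) (hq : q ≠ 0) (hq2 : q ^ 2 ≠ 1)
    (μ : ℂ) (hμ : μ = 1 - q⁻¹ ^ 2)
    (br : ℕ → ℂ) (hbr : ∀ n : ℕ, br n = (q ^ n - q⁻¹ ^ n) / (q - q⁻¹))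
    (P : Type*) [Ring P] [Algebra ℂ P]
    (a b c d : P) (D : Pˣ) (hD : (D : P) = d)
    (dz : ℤ → P) (hdz : ∀ t : ℤ, dz t = ((D ^ t : Pˣ) : P))
    (hba : b * a = q • (a * b)) (hca : c * a = q • (a * c))
    (hdb : d * b = q • (b * d)) (hdc : d * c = q • (c * d))
    (hcb : c * b = b * c)
    (hda : d * a - a * d = (q * μ) • (b * c))
    (had : a * d - q⁻¹ • (b * c) = 1)
    (ea eb ec ed : P)
    (r1 : ea * a = q • (a * ea)) (r2 : ea * b = q⁻¹ • (b * ea))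
    (r3 : ea * c = q • (c * ea)) (r4 : ea * d = q⁻¹ • (d * ea))
    (r5 : ec * b = b * ec) (r6 : ec * d = d * ec)
    (r7 : eb * a = a * eb) (r8 : eb * c = c * eb)
    (r9 : ec * a - a * ec = (q * μ) • (b * ea))
    (r10 : ec * c - c * ec = (q * μ) • (d * ea))
    (r11 : eb * b - b * eb = (q * μ) • (a * ea))
    (r12 : eb * d - d * eb = (q * μ) • (c * ea))
    (r13 : ed * a - q⁻¹ • (a * ed) = μ • (b * eb))
    (r14 : ed * b - q • (b * ed) = μ • (a * ec) + (q * μ ^ 2) • (b * ea))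
    (r15 : ed * c - q⁻¹ • (c * ed) = μ • (d * eb))
    (r16 : ed * d - q • (d * ed) = μ • (c * ec) + (q * μ ^ 2) • (d * ea))
    (k n m : ℕ) :
    ed * (c ^ k * b ^ n * dz m) =
      (q * μ ^ 2 * br (k + 1) * br (m + n)) • (c ^ k * b ^ n * dz m * ea) +
      (q * μ ^ 2 * q ^ (-(m : ℤ)) * br k * br n) • (c ^ (k - 1) * b ^ (n - 1) * dz m * ea) +
      (μ * br k * q ^ (n : ℤ)) • (c ^ (k - 1) * b ^ n * dz (m + 1) * eb) +
      (q ^ (-(k : ℤ)) * μ * br n) • (c ^ k * b ^ (n - 1) * dz ((m : ℤ) - 1) * ec) +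
      (q ^ (-(k : ℤ)) * μ * q⁻¹ * (q ^ ((m : ℤ) + n) * br m + br n)) •
        (c ^ (k + 1) * b ^ n * dz ((m : ℤ) - 1) * ec) +
      q ^ (-(k : ℤ) + n + m) • (c ^ k * b ^ n * dz m * ed) := by
  have hsub : q - q⁻¹ ≠ 0 := by
    intro h
    apply hq2
    field_simp at h
    linear_combination h
  have h0 : br 0 = 0 := by simp [hbr]
  have hadd : ∀ m n, br (m + n) = q ^ n * br m + q⁻¹ ^ m * br n := by
    intro m n
    simp only [hbr, pow_add]
    field_simp
    ring
  have h1 : br 1 = 1 := by simp [hbr, hsub]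
  have hqQ : q * q⁻¹ = 1 := mul_inv_cancel₀ hq
  have hrec : ∀ n, br (n + 1) = q ^ n + q⁻¹ * br n := by
    intro n; rw [add_comm, hadd, h1]; ring
  have hrec' : ∀ n, br (n + 1) = q⁻¹ ^ n + q * br n := by
    intro n; rw [hadd, h1]; ring
  clear hbr hsub hq2
  have hdm : dz m = d ^ m := by simp [hdz, hD]
  have hdm1 : dz (m + 1) = d * d ^ m := by
    rw [hdz, ← pow_succ', ← hD]; norm_cast
  have hdpred : d * dz ((m : ℤ) - 1) = d ^ m := by
    rw [hdz, ← hD, ← Units.val_mul, ← zpow_one_add]; simp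
  have hda' : d * a = 1 + q • (b * c) := by
    have : a * d = 1 + q⁻¹ • (b * c) := by rw [← had]; abel
    rw [eq_add_of_sub_eq hda, this, hμ]
    match_scalars
    · field_simp; ring
    · rfl
  have hadm : a * d ^ m = dz ((m : ℤ) - 1) + q⁻¹ • (b * (c * dz ((m : ℤ) - 1))) := by
    rw [← hdpred, ← mul_assoc, eq_add_of_sub_eq had, add_mul, one_mul, smul_mul_assoc, mul_assoc]
  have ea_d := mul_pow_of_mul_eq_smul r4 m
  have ec_d : ec * d ^ m = d ^ m * ec := ((show Commute ec d from r6).pow_right m).eq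
  have eb_d : eb * d ^ m = d ^ m * eb + (q * μ * br m) • (c * (dz ((m : ℤ) - 1) * ea)) := by
    rcases m with _ | m
    · simp [h0]
    · have := mul_pow_of_qDerivation hrec h0 (eq_add_of_sub_eq' r12) r4 hdc m
      rw [this]; simp [hdz, hD]
  have ed_d : ed * d ^ m = q ^ m • (d ^ m * ed) +
      ((μ * (q⁻¹ * q ^ m) * br m) • (c * (dz ((m : ℤ) - 1) * ec)) +
        (q * μ ^ 2 * br m) • (d ^ m * ea)) := by
    rcases m with _ | m
    · simp [h0]
    · have := mul_pow_of_qDerivation_two hqQ hrec h0 (eq_add_of_sub_eq' r16) r6 r4 hdc m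
      rw [this, show q⁻¹ * q ^ (m + 1) = q ^ m by field_simp; ring]; simp [hdz, hD]
  have hcn : ∀ n z, b ^ n * (c * z) = c * (b ^ n * z) := fun n z => by
    rw [← mul_assoc, ← mul_assoc, ((show Commute c b from hcb).pow_right n).eq]
  have hdbn : ∀ n z, d * (b ^ n * z) = q ^ n • (b ^ n * (d * z)) := fun n z => by
    rw [← mul_assoc, mul_pow_of_mul_eq_smul hdb, smul_mul_assoc, mul_assoc]
  have hdcz : ∀ z, d * (c * z) = q • (c * (d * z)) := fun z => by
    rw [← mul_assoc, hdc, smul_mul_assoc, mul_assoc]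
  have hbz : ∀ n z, b ^ n * (b * z) = b ^ (n + 1) * z := fun n z => by
    rw [← mul_assoc, ← pow_succ]
  have hbz' : ∀ n z, b * (b ^ n * z) = b ^ (n + 1) * z := fun n z => by
    rw [← mul_assoc, ← pow_succ']
  have hcz : ∀ n z, c ^ n * (c * z) = c ^ (n + 1) * z := fun n z => by
    rw [← mul_assoc, ← pow_succ]
  have hdpred' : ∀ z, d * (dz ((m : ℤ) - 1) * z) = d ^ m * z := fun z => by
    rw [← mul_assoc, hdpred]
  have ed_bd : ed * (b ^ n * d ^ m) = (q ^ n * q ^ m) • (b ^ n * (d ^ m * ed)) +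
      (q * μ ^ 2 * br (m + n)) • (b ^ n * (d ^ m * ea)) +
      (μ * br n) • (b ^ (n - 1) * (dz ((m : ℤ) - 1) * ec)) +
      (μ * q⁻¹ * (q ^ n * q ^ m * br m + br n)) •
        (c * (b ^ n * (dz ((m : ℤ) - 1) * ec))) := by
    rcases n with _ | n
    · simp [h0, ed_d]
      module
    · have E := mul_pow_of_qDerivation_two hqQ hrec h0 (eq_add_of_sub_eq' r14) r5 r2 hba n
      have e := pow_mul_of_mul_eq_smul hba n
      rw [mul_assoc μ, mul_comm (q ^ n), ← mul_assoc, mul_smul, ← mul_assoc a,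
        ← smul_mul_assoc (q ^ n) (a * b ^ n), ← e] at E
      rw [← mul_assoc ed, E, hadd m (n + 1)]
      simp only [add_mul, smul_mul_assoc, mul_assoc, ed_d, ea_d, ec_d, mul_add, mul_smul_comm, hcn]
      rw [← mul_assoc a, hadm]
      simp only [add_mul, smul_mul_assoc, mul_assoc, mul_add, mul_smul_comm, hbz, hcn,
        Nat.add_sub_cancel]
      match_scalars <;> ring
  have eb_bd : d * (eb * (b ^ n * d ^ m)) = q ^ n • (b ^ n * (d * (d ^ m * eb))) +
      (q * μ * q * br (m + n)) • (c * (b ^ n * (d ^ m * ea))) +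
      (q * μ * q⁻¹ ^ m * br n) • (b ^ (n - 1) * (d ^ m * ea)) := by
    rcases n with _ | n
    · simp only [h0, pow_zero, one_mul, eb_d, mul_add, mul_smul_comm, hdcz, hdpred', add_zero]
      module
    · have E := mul_pow_of_qDerivation hrec h0 (eq_add_of_sub_eq' r11) r2 hba n
      rw [← mul_assoc eb, E, hadd m (n + 1)]
      simp only [add_mul, smul_mul_assoc, mul_assoc, eb_d, ea_d, mul_add, mul_smul_comm,
        hdbn, hdcz, hdpred', hcn]
      rw [← mul_assoc d a, hda']
      simp only [add_mul, smul_mul_assoc, mul_assoc, one_mul, ← hcb, hbz', Nat.add_sub_cancel]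
      module
  have hz1 : q ^ (-(k : ℤ)) = q⁻¹ ^ k := by simp
  have hz2 : q ^ (-(m : ℤ)) = q⁻¹ ^ m := by simp
  have hz3 : q ^ (-(k : ℤ) + n + m) = q⁻¹ ^ k * q ^ n * q ^ m := by
    rw [zpow_add₀ hq, zpow_add₀ hq, hz1]; simp
  have hz4 : q ^ ((m : ℤ) + n) = q ^ n * q ^ m := by
    rw [zpow_add₀ hq, mul_comm]; simp
  rw [hz1, hz2, hz3, hz4, zpow_natCast, hdm, hdm1]
  rcases k with _ | k
  · simp only [pow_zero, one_mul, ed_bd, h0, h1, zero_add, pow_one, mul_assoc]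
    module
  · have E := mul_pow_of_qDerivation_inv hrec' h0 (eq_add_of_sub_eq' r15) r8 hdc k
    rw [mul_assoc, ← mul_assoc ed, E, add_mul, smul_mul_assoc, smul_mul_assoc, mul_assoc, ed_bd,
      mul_assoc (c ^ k), mul_assoc d, eb_bd, hrec' (k + 1)]
    simp only [mul_add, mul_smul_comm, hcz, mul_assoc, Nat.add_sub_cancel]
    match_scalars <;> ring
end

section
/- (Formula for the exterior derivative on basis monomials.) For all natural numbers k, n, m, with θ = e_a + e_d and d f := μ⁻¹(θ f − f θ), one has d(c^k b^n d^m) = μ⁻¹(q^{m+n−k} − 1) c^k b^n d^m e_d + q^{n−k+1}[k]_{q²} c^{k−1} b^n d^{m+1} e_b + q^{−k−n}([m+n]_{q²} c^{k+1} b^n d^{m−1} + q [n]_{q²} c^k b^{n−1} d^{m−1}) e_c + μ q^{−k−m−n+2}([k+1]_{q²}[m+n]_{q²} c^k b^n d^m + q [n]_{q²}[k]_{q²} c^{k−1} b^{n−1} d^m) e_a + μ⁻¹(q^{−m−n+k} − 1) c^k b^n d^m e_a, with the convention that a summand whose coefficient contains [0]_{q²} (i.e. which would involve a negative power of b or c)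 is zero; powers d^{m−1} with m = 0 are interpreted using the inverse of d. -/
/-- The `q`-number `[n]_{q²}` splits along sums. -/
lemma qNumber_add {q : ℂ} {br2 : ℕ → ℂ}
    (hbr2 : ∀ n : ℕ, br2 n = (1 - q ^ (2 * n)) / (1 - q ^ 2)) (m n : ℕ) :
    br2 (m + n) = br2 n + q ^ (2 * n) * br2 m := by
  simp only [hbr2]
  ring

lemma mul_pow_of_twisted {P : Type*} [Ring P] [Algebra ℂ P] {x u : P} {α : ℂ}
    (h : x * u = α • (u * x)) (n : ℕ) : x * u ^ n = α ^ n • (u ^ n * x) := by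
  induction n with
  | zero => simp
  | succ n ih =>
    rw [pow_succ u, ← mul_assoc, ih, smul_mul_assoc, mul_assoc, h, mul_smul_comm, smul_smul,
      ← pow_succ, mul_assoc]

/-- Moving a skew derivation `x` past a power of `u`, when the inner parts `v y` and `v' y'`
commute with `u` up to scalars. -/
lemma mul_pow_of_skew {P : Type*} [Ring P] [Algebra ℂ P] {x u v y v' y' : P}
    {α γ δ γ' δ' : ℂ} (h : x * u = α • (u * x) + v * y + v' * y')
    (hy : y * u = γ • (u * y)) (hv : u * v = δ • (v * u))
    (hy' : y' * u = γ' • (u * y')) (hv' : u * v' = δ' • (v' * u))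
    (n : ℕ) :
    x * u ^ n = α ^ n • (u ^ n * x)
      + (∑ i ∈ Finset.range n, (α * δ) ^ i * γ ^ (n - 1 - i)) • (v * u ^ (n - 1) * y)
      + (∑ i ∈ Finset.range n, (α * δ') ^ i * γ' ^ (n - 1 - i)) • (v' * u ^ (n - 1) * y') := by
  induction n with
  | zero => simp
  | succ n ih =>
    have absorb : ∀ (v y : P) (γ δ : ℂ), y * u = γ • (u * y) →
        (∑ i ∈ Finset.range n, (α * δ) ^ i * γ ^ (n - 1 - i)) • (v * u ^ (n - 1) * y) * u =
          (γ * ∑ i ∈ Finset.range n, (α * δ) ^ i * γ ^ (n - 1 - i)) • (v * u ^ n * y) := by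
      intro v y γ δ hy
      rcases n with _ | n
      · simp
      · rw [smul_mul_assoc, mul_assoc _ y, hy, mul_smul_comm, smul_smul, mul_comm γ,
          ← mul_assoc, mul_assoc v, Nat.add_sub_cancel, ← pow_succ]
    have swap : ∀ (v y : P) (δ : ℂ), u * v = δ • (v * u) →
        u ^ n * (v * y) = δ ^ n • (v * u ^ n * y) := by
      intro v y δ hv
      have : u ^ n * v = δ ^ n • (v * u ^ n) := by
        clear ih absorb
        induction n with
        | zero => simp
        | succ n ih =>
          rw [pow_succ u, mul_assoc, hv, mul_smul_comm, ← mul_assoc, ih, smul_mul_assoc,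
            smul_smul, mul_assoc, pow_succ, mul_comm δ]
      rw [← mul_assoc, this, smul_mul_assoc]
    have coeff : ∀ γ δ : ℂ, ∑ i ∈ Finset.range (n + 1), (α * δ) ^ i * γ ^ (n + 1 - 1 - i) =
        α ^ n * δ ^ n + γ * ∑ i ∈ Finset.range n, (α * δ) ^ i * γ ^ (n - 1 - i) := by
      intro γ δ
      rw [Finset.sum_range_succ, Finset.mul_sum, Nat.add_sub_cancel, Nat.sub_self, pow_zero,
        mul_one, mul_pow, add_comm]
      congr 1
      refine Finset.sum_congr rfl fun i hi => ?_
      obtain ⟨j, rfl⟩ := Nat.exists_eq_add_of_lt (Finset.mem_range.mp hi)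
      rw [show i + j + 1 - i = j + 1 by omega, show i + j + 1 - 1 - i = j by omega]
      ring
    rw [coeff, coeff, pow_succ u, ← mul_assoc, ih, add_mul, add_mul, absorb v y γ δ hy,
      absorb v' y' γ' δ' hy', smul_mul_assoc, mul_assoc _ x, h, mul_add, mul_add, swap v y δ hv,
      swap v' y' δ' hv', mul_smul_comm, ← mul_assoc, Nat.add_sub_cancel]
    module


/-- formula for the exterior derivative `d f = μ⁻¹(θ f − f θ)`,
`θ = e_a + e_d`, on the basis monomials `cᵏ bⁿ dᵐ` (equation (7) of the paper),
with `[n]_{q²} = (1 − q^{2n})/(1 − q²)`, the convention that a summand whose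
coefficient contains `[0]_{q²}` is zero, and `d^{m−1}` taken via the unit `D`. -/
theorem exterior_derivative_on_monomials
    (q : ℂ) (hq : q ≠ 0) (hq2 : q ^ 2 ≠ 1)
    (μ : ℂ) (hμ : μ = 1 - q⁻¹ ^ 2)
    (br : ℕ → ℂ) (hbr : ∀ n : ℕ, br n = (q ^ n - q⁻¹ ^ n) / (q - q⁻¹))
    (P : Type*) [Ring P] [Algebra ℂ P]
    (a b c d : P) (D : Pˣ) (hD : (D : P) = d)
    (dz : ℤ → P) (hdz : ∀ t : ℤ, dz t = ((D ^ t : Pˣ) : P))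
    (hba : b * a = q • (a * b)) (hca : c * a = q • (a * c))
    (hdb : d * b = q • (b * d)) (hdc : d * c = q • (c * d))
    (hcb : c * b = b * c)
    (hda : d * a - a * d = (q * μ) • (b * c))
    (had : a * d - q⁻¹ • (b * c) = 1)
    (ea eb ec ed : P)
    (r1 : ea * a = q • (a * ea)) (r2 : ea * b = q⁻¹ • (b * ea))
    (r3 : ea * c = q • (c * ea)) (r4 : ea * d = q⁻¹ • (d * ea))
    (r5 : ec * b = b * ec) (r6 : ec * d = d * ec)
    (r7 : eb * a = a * eb) (r8 : eb * c = c * eb)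
    (r9 : ec * a - a * ec = (q * μ) • (b * ea))
    (r10 : ec * c - c * ec = (q * μ) • (d * ea))
    (r11 : eb * b - b * eb = (q * μ) • (a * ea))
    (r12 : eb * d - d * eb = (q * μ) • (c * ea))
    (r13 : ed * a - q⁻¹ • (a * ed) = μ • (b * eb))
    (r14 : ed * b - q • (b * ed) = μ • (a * ec) + (q * μ ^ 2) • (b * ea))
    (r15 : ed * c - q⁻¹ • (c * ed) = μ • (d * eb))
    (r16 : ed * d - q • (d * ed) = μ • (c * ec) + (q * μ ^ 2) • (d * ea))
    (br2 : ℕ → ℂ) (hbr2 : ∀ n : ℕ, br2 n = (1 - q ^ (2 * n)) / (1 - q ^ 2))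
    (θ : P) (hθ : θ = ea + ed)
    (k n m : ℕ) :
    μ⁻¹ • (θ * (c ^ k * b ^ n * dz m) - c ^ k * b ^ n * dz m * θ) =
      (μ⁻¹ * (q ^ ((m : ℤ) + n - k) - 1)) • (c ^ k * b ^ n * dz m * ed) +
      (q ^ ((n : ℤ) - k + 1) * br2 k) • (c ^ (k - 1) * b ^ n * dz (m + 1) * eb) +
      (q ^ (-(k : ℤ) - n) * br2 (m + n)) • (c ^ (k + 1) * b ^ n * dz ((m : ℤ) - 1) * ec) +
      (q ^ (-(k : ℤ) - n) * q * br2 n) • (c ^ k * b ^ (n - 1) * dz ((m : ℤ) - 1) * ec) +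
      (μ * q ^ (-(k : ℤ) - m - n + 2) * br2 (k + 1) * br2 (m + n)) • (c ^ k * b ^ n * dz m * ea) +
      (μ * q ^ (-(k : ℤ) - m - n + 2) * q * br2 n * br2 k) • (c ^ (k - 1) * b ^ (n - 1) * dz m * ea) +
      (μ⁻¹ * (q ^ ((k : ℤ) - m - n) - 1)) • (c ^ k * b ^ n * dz m * ea) := by
  have hq2' : (1 : ℂ) - q ^ 2 ≠ 0 := sub_ne_zero.mpr (Ne.symm hq2)
  have hqi : q - q⁻¹ ≠ 0 := by
    intro h
    apply hq2
    field_simp at h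
    linear_combination h
  have hμ0 : μ ≠ 0 := by
    intro h
    apply hqi
    rw [hμ] at h
    field_simp at h ⊢
    linear_combination h
  have br2_zero : br2 0 = 0 := by simp [hbr2]
  have sum_balanced : ∀ n : ℕ, ∑ i ∈ Finset.range n, (q : ℂ) ^ i * q⁻¹ ^ (n - 1 - i) =
      q * (q ^ n)⁻¹ * br2 n := by
    intro n
    rw [geom₂_sum (sub_ne_zero.mp hqi), hbr2, pow_mul', inv_pow]
    have : q ^ 2 - 1 ≠ 0 := sub_ne_zero.mpr hq2
    field_simp
    ring
  have sum_square : ∀ n : ℕ, ∑ i ∈ Finset.range n, (q * q : ℂ) ^ i * 1 ^ (n - 1 - i) =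
      br2 n := by
    intro n
    have : q ^ 2 - 1 ≠ 0 := sub_ne_zero.mpr hq2
    rw [geom₂_sum (by rwa [← pow_two]), hbr2, one_pow, ← pow_two, ← pow_mul]
    field_simp
    ring
  have sum_inv_square : ∀ n : ℕ, ∑ i ∈ Finset.range n, (q⁻¹ * q⁻¹ : ℂ) ^ i * 1 ^ (n - 1 - i) =
      q ^ 2 * (q ^ n)⁻¹ ^ 2 * br2 n := by
    intro n
    have : q ^ 2 - 1 ≠ 0 := sub_ne_zero.mpr hq2
    rw [geom₂_sum (by rw [← pow_two, inv_pow]; simpa using hq2), hbr2, one_pow, ← pow_two,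
      ← pow_mul, inv_pow, pow_mul' q 2 n]
    field_simp
  set w : P := dz ((m : ℤ) - 1) with hw
  set i : P := dz (-1) with hi
  have hdm : dz m = d ^ m := by rw [hdz, zpow_natCast, Units.val_pow_eq_pow_val, hD]
  have hdm1 : dz (m + 1) = d * d ^ m := by
    rw [hdz, ← hD, ← Units.val_pow_eq_pow_val, ← Units.val_mul, ← zpow_natCast, add_comm,
      zpow_one_add]
  have hdw : d * w = d ^ m := by
    rw [hw, hdz, ← hdm, hdz, ← hD, ← Units.val_mul, ← zpow_one_add]
    simp
  have hiw : i * d ^ m = w := by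
    rw [hw, hi, hdz, hdz, ← hdm, hdz, ← Units.val_mul, ← zpow_add]
    ring_nf
  have hdi : d * i = 1 := by
    rw [hi, hdz, ← hD, ← Units.val_mul]
    simp
  have hid : i * d = 1 := by
    rw [hi, hdz, ← hD, ← Units.val_mul]
    simp
  have br2_pow : ∀ (u : P) (t : ℕ), br2 t • (u * u ^ (t - 1)) = br2 t • u ^ t := by
    intro u t
    rcases t with _ | t
    · simp [br2_zero]
    · rw [Nat.add_sub_cancel, pow_succ']
  have br2_w : br2 m • d ^ (m - 1) = br2 m • w := by
    rcases m with _ | t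
    · simp [br2_zero]
    · congr 1
      rw [hw, hdz, Nat.add_sub_cancel, ← hD, ← Units.val_pow_eq_pow_val, ← zpow_natCast]
      simp
  have hai : a = i + q⁻¹ • (b * c * i) := by
    have : a * d * i = (1 + q⁻¹ • (b * c)) * i := by rw [← had]; congr 1; abel
    rw [mul_assoc, hdi, mul_one, add_mul, one_mul, smul_mul_assoc] at this
    exact this
  have hda' : d * a = 1 + q • (b * c) := by
    have : d * a = 1 + q⁻¹ • (b * c) + (q * μ) • (b * c) := by rw [← hda, ← had]; abel
    rw [this, hμ, add_assoc, ← add_smul]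
    congr 2
    field_simp
    ring
  have ec_pow : ec * d ^ m = d ^ m * ec := (Commute.pow_right (show Commute ec d from r6) m).eq
  have cb : ∀ s t : ℕ, c ^ s * b ^ t = b ^ t * c ^ s := fun s t =>
    (Commute.pow_pow (show Commute c b from hcb) s t).eq
  have hib : i * b = q⁻¹ • (b * i) := by
    have : i * (d * b) * i = q • (i * (b * d) * i) := by rw [hdb, mul_smul_comm, smul_mul_assoc]
    rw [← mul_assoc i d, hid, one_mul, mul_assoc, mul_assoc b, hdi, mul_one] at this
    rw [this, smul_smul, inv_mul_cancel₀ hq, one_smul]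
  have a_mul_pow : ∀ t : ℕ, a * b ^ t = (q ^ t)⁻¹ • (b ^ t * i)
      + (q⁻¹ * (q ^ t)⁻¹) • (c * b ^ (t + 1) * i) := by
    intro t
    have h1 : b * c * b ^ t = c * b ^ (t + 1) := by
      rw [← hcb, mul_assoc, ← pow_succ']
    rw [hai, add_mul, smul_mul_assoc, mul_assoc (b * c), mul_pow_of_twisted hib, mul_smul_comm,
      ← mul_assoc, h1, smul_smul, inv_pow]
  have ed_mul_c_pow : ed * c ^ k = (q ^ k)⁻¹ • (c ^ k * ed)
      + (μ * q * (q ^ k)⁻¹ * br2 k) • (c ^ (k - 1) * d * eb) := by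
    have h := mul_pow_of_skew (x := ed) (u := c) (v := d) (y := μ • eb) (v' := 0) (y' := 0)
      (α := q⁻¹) (γ := 1) (δ := q⁻¹) (γ' := 0) (δ' := 0)
      (by rw [mul_smul_comm, ← r15]; simp) (by rw [smul_mul_assoc, r8, mul_smul_comm, one_smul])
      (by rw [hdc, smul_smul, inv_mul_cancel₀ hq, one_smul]) (by simp) (by simp) k
    rw [sum_inv_square, mul_pow_of_twisted hdc] at h
    rw [h]
    rcases k with _ | t
    · simp [br2_zero]
    · simp only [inv_pow, smul_mul_assoc, mul_smul_comm, smul_smul, zero_mul, smul_zero, add_zero,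
        Nat.add_sub_cancel]
      congr 2
      field_simp
      ring
  have ed_mul_b_pow : ed * b ^ n = q ^ n • (b ^ n * ed)
      + (μ * (q ^ n)⁻¹ * br2 n) • (c * b ^ n * i * ec)
      + (μ * (q ^ n)⁻¹ * q * br2 n) • (b ^ (n - 1) * i * ec)
      + (μ ^ 2 * q ^ 2 * (q ^ n)⁻¹ * br2 n) • (b ^ n * ea) := by
    have h := mul_pow_of_skew (x := ed) (u := b) (v := a) (y := μ • ec) (v' := b)
      (y' := (q * μ ^ 2) • ea)
      (α := q) (γ := 1) (δ := q) (γ' := q⁻¹) (δ' := 1)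
      (by rw [mul_smul_comm, mul_smul_comm, add_assoc, ← r14]; abel)
      (by rw [smul_mul_assoc, r5, mul_smul_comm, one_smul])
      hba (by rw [smul_mul_assoc, r2, mul_smul_comm, smul_comm]) (by simp) n
    rw [sum_square, mul_one q, sum_balanced] at h
    rw [h]
    rcases n with _ | t
    · simp [br2_zero]
    · rw [Nat.add_sub_cancel, a_mul_pow, ← pow_succ']
      simp only [add_mul, smul_mul_assoc, mul_smul_comm]
      match_scalars <;> field_simp <;> ring
  have ed_mul_d_pow : ed * d ^ m = q ^ m • (d ^ m * ed) + (μ * br2 m) • (c * w * ec)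
      + (μ ^ 2 * q ^ 2 * (q ^ m)⁻¹ * br2 m) • (d ^ m * ea) := by
    have h := mul_pow_of_skew (x := ed) (u := d) (v := c) (y := μ • ec) (v' := d)
      (y' := (q * μ ^ 2) • ea)
      (α := q) (γ := 1) (δ := q) (γ' := q⁻¹) (δ' := 1)
      (by rw [mul_smul_comm, mul_smul_comm, add_assoc, ← r16]; abel)
      (by rw [smul_mul_assoc, r6, mul_smul_comm, one_smul])
      hdc (by rw [smul_mul_assoc, r4, mul_smul_comm, smul_comm]) (by simp) m
    have hc := congrArg (fun x => c * x * ec) br2_w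
    have hd := congrArg (fun x => x * ea) (br2_pow d m)
    simp only [smul_mul_assoc, mul_smul_comm] at hc hd
    rw [sum_square, mul_one q, sum_balanced, mul_smul_comm, mul_smul_comm, smul_comm (br2 m) μ, hc,
      mul_smul (q * _) (br2 m), smul_comm (br2 m) (q * μ ^ 2), hd] at h
    rw [h]
    module
  have d_mul_eb_mul_b_pow : d * (eb * b ^ n) = q ^ n • (b ^ n * d * eb)
      + (μ * q ^ 2 * (q ^ n)⁻¹ * br2 n) • (b ^ (n - 1) * ea)
      + (μ * q ^ 3 * (q ^ n)⁻¹ * br2 n) • (c * b ^ n * ea) := by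
    have h := mul_pow_of_skew (x := eb) (u := b) (v := a) (y := (q * μ) • ea) (v' := 0)
      (y' := 0) (α := 1) (γ := q⁻¹) (δ := q) (γ' := 0) (δ' := 0)
      (by rw [mul_smul_comm, ← r11]; simp)
      (by rw [smul_mul_assoc, r2, mul_smul_comm, smul_comm]) hba (by simp) (by simp) n
    simp only [one_mul, one_pow, one_smul] at h
    rw [sum_balanced] at h
    rw [h, mul_add, mul_add]
    rcases n with _ | t
    · simp [br2_zero]
    · have hd : d * (a * b ^ t * ea) = b ^ t * ea + q • (c * b ^ (t + 1) * ea) := by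
        rw [← mul_assoc, ← mul_assoc, hda', add_mul, one_mul, add_mul, smul_mul_assoc,
          ← hcb, mul_assoc c, ← pow_succ', smul_mul_assoc]
      rw [Nat.add_sub_cancel, ← mul_assoc, mul_pow_of_twisted hdb]
      simp only [smul_mul_assoc, mul_smul_comm, hd, zero_mul, mul_zero, smul_zero]
      match_scalars <;> field_simp
  have eb_mul_d_pow : eb * d ^ m = d ^ m * eb + (μ * q ^ 2 * (q ^ m)⁻¹ * br2 m) • (c * w * ea) := by
    have h := mul_pow_of_skew (x := eb) (u := d) (v := c) (y := (q * μ) • ea) (v' := 0)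
      (y' := 0) (α := 1) (γ := q⁻¹) (δ := q) (γ' := 0) (δ' := 0)
      (by rw [mul_smul_comm, ← r12]; simp)
      (by rw [smul_mul_assoc, r4, mul_smul_comm, smul_comm]) hdc (by simp) (by simp) m
    have hc := congrArg (fun x => c * x * ea) br2_w
    simp only [smul_mul_assoc, mul_smul_comm] at hc
    simp only [one_mul, one_pow, one_smul] at h
    rw [sum_balanced, mul_smul_comm, mul_smul (q * _) (br2 m), smul_comm (br2 m) (q * μ), hc] at h
    rw [h, zero_mul, zero_mul, smul_zero]
    module
  have ed_mul_b_pow_mul_d_pow : ed * b ^ n * d ^ m = (q ^ n * q ^ m) • (b ^ n * d ^ m * ed)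
      + (μ * (q ^ n)⁻¹ * br2 (m + n)) • (c * b ^ n * w * ec)
      + (μ * (q ^ n)⁻¹ * q * br2 n) • (b ^ (n - 1) * w * ec)
      + (μ ^ 2 * q ^ 2 * (q ^ n)⁻¹ * (q ^ m)⁻¹ * br2 (m + n)) • (b ^ n * d ^ m * ea) := by
    have hbc : b ^ n * (c * w * ec) = c * b ^ n * w * ec := by
      have := cb 1 n
      rw [pow_one] at this
      rw [this]
      simp only [mul_assoc]
    have hec : ∀ x : P, x * i * ec * d ^ m = x * w * ec := fun x => by
      rw [mul_assoc _ ec, ec_pow, ← mul_assoc, mul_assoc x, hiw]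
    have hbd : b ^ n * ea * d ^ m = (q ^ m)⁻¹ • (b ^ n * d ^ m * ea) := by
      rw [mul_assoc, mul_pow_of_twisted r4, mul_smul_comm, inv_pow, mul_assoc]
    rw [ed_mul_b_pow, add_mul, add_mul, add_mul]
    simp only [smul_mul_assoc, hec, hbd]
    rw [mul_assoc _ ed, ed_mul_d_pow]
    simp only [mul_add, mul_smul_comm, hbc, ← mul_assoc (b ^ n) (d ^ m)]
    rw [qNumber_add hbr2, pow_mul']
    match_scalars <;> field_simp <;> ring
  have d_mul_eb_mul_b_pow_mul_d_pow : d * (eb * b ^ n) * d ^ m = q ^ n • (b ^ n * (d * d ^ m) * eb)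
      + (μ * q ^ 2 * (q ^ n)⁻¹ * (q ^ m)⁻¹ * br2 n) • (b ^ (n - 1) * d ^ m * ea)
      + (μ * q ^ 3 * (q ^ n)⁻¹ * (q ^ m)⁻¹ * br2 (m + n)) • (c * (b ^ n * d ^ m * ea)) := by
    have hbc : b ^ n * d * (c * w * ea) = q • (c * (b ^ n * d ^ m * ea)) := by
      have := cb 1 n
      rw [pow_one] at this
      rw [mul_assoc, ← mul_assoc d, ← mul_assoc d, hdc, smul_mul_assoc, mul_assoc c, hdw,
        smul_mul_assoc, mul_smul_comm, ← mul_assoc, ← mul_assoc, ← this, mul_assoc, mul_assoc,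
        mul_assoc]
    have hea : ∀ x : P, x * ea * d ^ m = (q ^ m)⁻¹ • (x * d ^ m * ea) := fun x => by
      rw [mul_assoc, mul_pow_of_twisted r4, mul_smul_comm, inv_pow, mul_assoc]
    rw [d_mul_eb_mul_b_pow, add_mul, add_mul]
    simp only [smul_mul_assoc, hea]
    rw [mul_assoc _ eb, eb_mul_d_pow, mul_add, mul_smul_comm, hbc, qNumber_add hbr2, pow_mul']
    simp only [mul_assoc]
    match_scalars <;> field_simp <;> ring
  have hck : br2 k • (c ^ (k - 1) * (c * (b ^ n * d ^ m * ea))) =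
      br2 k • (c ^ k * (b ^ n * d ^ m * ea)) := by
    rw [← mul_assoc (c ^ (k - 1)), ← pow_succ, pow_succ', ← smul_mul_assoc, br2_pow,
      smul_mul_assoc]
  have ed_mul_monomial : ed * (c ^ k * b ^ n * d ^ m) = (q ^ k)⁻¹ • (c ^ k * (ed * b ^ n * d ^ m))
      + (μ * q * (q ^ k)⁻¹ * br2 k) • (c ^ (k - 1) * (d * (eb * b ^ n) * d ^ m)) := by
    rw [← mul_assoc, ← mul_assoc, ed_mul_c_pow]
    simp only [add_mul, smul_mul_assoc, mul_assoc]
  have ea_mul_monomial : ea * (c ^ k * b ^ n * d ^ m) =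
      (q ^ k * (q ^ n)⁻¹ * (q ^ m)⁻¹) • (c ^ k * b ^ n * d ^ m * ea) := by
    rw [← mul_assoc, ← mul_assoc, mul_pow_of_twisted r3, smul_mul_assoc, mul_assoc _ ea,
      mul_pow_of_twisted r2, mul_smul_comm, smul_mul_assoc, smul_mul_assoc, ← mul_assoc,
      mul_assoc _ ea, mul_pow_of_twisted r4, mul_smul_comm, smul_smul, smul_smul, ← mul_assoc,
      inv_pow, inv_pow, mul_assoc (q ^ k)]
  have hbrk : br2 (k + 1) = 1 + q ^ 2 * br2 k := by
    rw [qNumber_add hbr2, hbr2 1, mul_one, div_self hq2']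
  have hckr : ∀ r : ℂ, (r * br2 k) • (c ^ (k - 1) * (c * (b ^ n * d ^ m * ea))) =
      (r * br2 k) • (c ^ k * (b ^ n * d ^ m * ea)) := fun r => by
    rw [mul_smul, hck, mul_smul]
  rw [hθ, hdm, hdm1, hbrk, add_mul, ed_mul_monomial, ea_mul_monomial, ed_mul_b_pow_mul_d_pow,
    d_mul_eb_mul_b_pow_mul_d_pow]
  simp only [mul_add, smul_add, mul_smul_comm, smul_smul]
  rw [show μ * q * (q ^ k)⁻¹ * br2 k * (μ * q ^ 3 * (q ^ n)⁻¹ * (q ^ m)⁻¹ * br2 (m + n)) =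
    μ * q * (q ^ k)⁻¹ * (μ * q ^ 3 * (q ^ n)⁻¹ * (q ^ m)⁻¹ * br2 (m + n)) * br2 k by ring,
    hckr, pow_succ c]
  simp only [zpow_add₀ hq, zpow_sub₀ hq, zpow_neg, zpow_natCast, zpow_ofNat,
    ← mul_assoc]
  match_scalars <;> field_simp <;> ring
end

section
/- (Existence part of Theorem 3.1.) The spin connection A given by A_a = (q⁴/[4]_{q²}) e_z = −A_d, A_b = (1/(q² + q⁻²)) e_b, A_c = (1/(q² + q⁻²)) e_c is torsion-free and cotorsion-free: for each i ∈ {a, b, c, d}, d e_i + Σ_{j,k} ad_L(jk|i) A_j e_k = 0 (torsion equation) and d e_i + Σ_{j,k} ad_R(jk|i) e_j A_k = 0 (cotorsion equation), where d e_i = μ⁻¹(θ e_i + e_i θ). -/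
/-- existence part of Theorem 3.1: the spin connection
`A_a = (q⁴/[4]_{q²}) e_z = −A_d`, `A_b = (1/(q²+q⁻²)) e_b`, `A_c = (1/(q²+q⁻²)) e_c`
is torsion free and cotorsion free: for each `i ∈ {a,b,c,d}`,
`d e_i + Σ_{j,k} ad_L(jk|i) A_j e_k = 0` and `d e_i + Σ_{j,k} ad_R(jk|i) e_j A_k = 0`,
where `d e_i = μ⁻¹(θ e_i + e_i θ)` and the sums are written out explicitly using the
structure constants `ad_L`, `ad_R` of the braided-Lie algebra. -/
theorem canonical_spin_connection_torsion_and_cotorsion_free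
    (q : ℂ) (hq : q ≠ 0) (hq2 : q ^ 2 ≠ 1) (hq2' : q ^ 2 ≠ -1) (hq4 : q ^ 4 ≠ -1)
    (μ : ℂ) (hμ : μ = 1 - q⁻¹ ^ 2)
    (br4 : ℂ) (hbr4 : br4 = (1 + q ^ 2) * (1 + q ^ 4))
    (Λ : Type*) [Ring Λ] [Algebra ℂ Λ]
    (ea eb ec ed ez θ : Λ)
    (hez : ez = q⁻¹ ^ 2 • ea - ed) (hθ : θ = ea + ed)
    (raa : ea * ea = 0) (rbb : eb * eb = 0) (rcc : ec * ec = 0)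
    (rab : ea * eb + eb * ea = 0) (rac : ea * ec + ec * ea = 0)
    (rbc : eb * ec + ec * eb = 0)
    (rad : ea * ed + ed * ea + μ • (ec * eb) = 0)
    (rdc : ed * ec + q ^ 2 • (ec * ed) + μ • (ea * ec) = 0)
    (rbd : eb * ed + q ^ 2 • (ed * eb) + μ • (eb * ea) = 0)
    (rdd : ed * ed = μ • (ec * eb))
    (Aa Ab Ac Ad : Λ)
    (hAa : Aa = (q ^ 4 / br4) • ez) (hAd : Ad = -Aa)
    (hAb : Ab = (q ^ 2 + q⁻¹ ^ 2)⁻¹ • eb) (hAc : Ac = (q ^ 2 + q⁻¹ ^ 2)⁻¹ • ec) :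
    -- torsion equations
    (μ⁻¹ • (θ * ea + ea * θ) +
      (Ac * eb - Ab * ec + μ • (Aa * ea - q ^ 2 • (Aa * ed))) = 0) ∧
    (μ⁻¹ • (θ * ed + ed * θ) +
      (Ab * ec - Ac * eb - μ • (Aa * ea - q ^ 2 • (Aa * ed))) = 0) ∧
    (μ⁻¹ • (θ * ec + ec * θ) +
      ((q ^ 2 • Aa - Ad) * ec - Ac * (q⁻¹ ^ 2 • ea - ed)) = 0) ∧
    (μ⁻¹ • (θ * eb + eb * θ) +
      (((q ^ 2 - 1 - q⁻¹ ^ 2) • Aa + q ^ 2 • Ad) * eb + Ab * (ea - q ^ 2 • ed)) = 0) ∧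
    -- cotorsion equations
    (μ⁻¹ • (θ * ea + ea * θ) +
      (ec * Ab - eb * Ac + μ • ((ea - q ^ 2 • ed) * Aa)) = 0) ∧
    (μ⁻¹ • (θ * ed + ed * θ) +
      (eb * Ac - ec * Ab - μ • ((ea - q ^ 2 • ed) * Aa)) = 0) ∧
    (μ⁻¹ • (θ * eb + eb * θ) +
      (eb * (q ^ 2 • Aa - Ad) - (q⁻¹ ^ 2 • ea - ed) * Ab) = 0) ∧
    (μ⁻¹ • (θ * ec + ec * θ) +
      (ec * ((q ^ 2 - 1 - q⁻¹ ^ 2) • Aa + q ^ 2 • Ad) + (ea - q ^ 2 • ed) * Ac) = 0) := by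
  have hsum : 1 + q ^ 2 ≠ 0 := fun h => hq2' (by linear_combination h)
  have hquart : 1 + q ^ 4 ≠ 0 := fun h => hq4 (by linear_combination h)
  have hdiff : q ^ 2 - 1 ≠ 0 := sub_ne_zero.mpr hq2
  have hμinv : μ⁻¹ = q ^ 2 / (q ^ 2 - 1) := by
    rw [hμ]
    field_simp
  have hcoeff : (q ^ 2 + q⁻¹ ^ 2)⁻¹ = q ^ 2 / (1 + q ^ 4) := by
    have h : q ^ 2 + q⁻¹ ^ 2 = (1 + q ^ 4) / q ^ 2 := by
      field_simp
      ring
    rw [h, inv_div]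
  have hba : eb * ea = -(ea * eb) := eq_neg_of_add_eq_zero_right rab
  have hca : ec * ea = -(ea * ec) := eq_neg_of_add_eq_zero_right rac
  have hbc : eb * ec = -(ec * eb) := eq_neg_of_add_eq_zero_left rbc
  have hda : ed * ea = -(ea * ed) - μ • (ec * eb) := by
    rw [← sub_eq_zero, ← rad]
    abel
  have hdc : ed * ec = -(q ^ 2 • (ec * ed)) - μ • (ea * ec) := by
    rw [← sub_eq_zero, ← rdc]
    abel
  have hbd : eb * ed = -(q ^ 2 • (ed * eb)) + μ • (ea * eb) := by
    rw [hba, smul_neg] at rbd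
    rw [← sub_eq_zero, ← rbd]
    abel
  rw [hμinv]
  subst hAd hAa hAb hAc hez hθ hbr4
  rw [hcoeff]
  refine ⟨?_, ?_, ?_, ?_, ?_, ?_, ?_, ?_⟩ <;>
  · simp only [add_mul, mul_add, sub_mul, mul_sub, smul_mul_assoc, mul_smul_comm, neg_mul, mul_neg,
      smul_neg, raa, rdd, hba, hca, hbc, hda, hdc, hbd, hμ]
    match_scalars <;> field_simp <;> ring
end
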